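/- Relative order: let α ∈ (0,1), π ∈ Π, and let 𝒬^π = (Q₁^π, Q₂^π) be the unique fixed point of T^π_α. Then for all (x,a) ∈ X×A, Q₁^π(x,a) ≤ Q^π(x,a) ≤ Q₂^π(x,a), where Q^π is the classical action-value function of π. -/

import Mathlib

open MeasureTheory ProbabilityTheory Finset Set

noncomputable section

/-- Quantile (generalized inverse distribution) function of a measure on `ℝ`. -/
def quantileFn (ν : Measure ℝ) (τ : ℝ) : ℝ :=
  sInf {z : ℝ | τ ≤ cdf ν z}

/-- Left average value-at-risk at level `α`. -/
def avarLeft (α : ℝ) (ν : Measure ℝ) : ℝ :=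
  (1 / α) * ∫ τ in (0:ℝ)..α, quantileFn ν τ

/-- Right average value-at-risk at level `1 - α`. -/
def avarRight (α : ℝ) (ν : Measure ℝ) : ℝ :=
  (1 / (1 - α)) * ∫ τ in α..(1:ℝ), quantileFn ν τ

/-- A measure on `ℝ` with bounded support. -/
def HasBoundedSupport (ν : Measure ℝ) : Prop :=
  ∃ a b : ℝ, ν (Set.Icc a b)ᶜ = 0

/-- Finite Markov decision process with fixed state and action spaces. -/
structure MDP (X A : Type) [Fintype X] [Fintype A] where
  P : X → A → X → ℝ
  r : X → A → X → ℝ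
  γ : ℝ
  P_nonneg : ∀ x a x', 0 ≤ P x a x'
  P_sum_one : ∀ x a, ∑ x', P x a x' = 1
  γ_nonneg : 0 ≤ γ
  γ_lt_one : γ < 1

variable {X A : Type} [Fintype X] [Fintype A]

/-- A stationary Markovian policy. -/
def IsPolicy (π : X → A → ℝ) : Prop :=
  (∀ x a, 0 ≤ π x a) ∧ ∀ x, ∑ a, π x a = 1

/-- The discrete measure `(T^π D_{α,Q})^{(x,a)}`. -/
def diatomicMeasure (M : MDP X A) (α : ℝ) (π : X → A → ℝ)
    (Q : X → A → ℝ × ℝ) (x : X) (a : A) : Measure ℝ :=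
  ∑ x' : X, ∑ a' : A, ENNReal.ofReal (M.P x a x' * π x' a') •
    (ENNReal.ofReal α • Measure.dirac (M.r x a x' + M.γ * (Q x' a').1)
      + ENNReal.ofReal (1 - α) • Measure.dirac (M.r x a x' + M.γ * (Q x' a').2))

/-- The diatomic Bellman operator `T^π_α`. -/
def diatomicT (M : MDP X A) (α : ℝ) (π : X → A → ℝ)
    (Q : X → A → ℝ × ℝ) : X → A → ℝ × ℝ :=
  fun x a => (avarLeft α (diatomicMeasure M α π Q x a),
              avarRight α (diatomicMeasure M α π Q x a))

lemma bddBelow_setOf_le_cdf (ν : Measure ℝ) {τ : ℝ} (hτ : 0 < τ) :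
    BddBelow {z : ℝ | τ ≤ cdf ν z} := by
  obtain ⟨b, hb⟩ := ((tendsto_cdf_atBot ν).eventually (gt_mem_nhds hτ)).exists
  refine ⟨b, fun z hz => le_of_not_gt fun hlt => ?_⟩
  exact (hz.trans (monotone_cdf ν hlt.le)).not_gt hb

lemma nonempty_setOf_le_cdf (ν : Measure ℝ) {τ : ℝ} (hτ : τ < 1) :
    {z : ℝ | τ ≤ cdf ν z}.Nonempty := by
  obtain ⟨b, hb⟩ := ((tendsto_cdf_atTop ν).eventually (lt_mem_nhds hτ)).exists
  exact ⟨b, hb.le⟩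

/-- The Galois connection between the quantile function and the distribution function. -/
lemma quantileFn_le_iff (ν : Measure ℝ) {τ : ℝ} (hτ : τ ∈ Set.Ioo (0 : ℝ) 1) (z : ℝ) :
    quantileFn ν τ ≤ z ↔ τ ≤ cdf ν z := by
  refine ⟨fun h => ?_, fun h => csInf_le (bddBelow_setOf_le_cdf ν hτ.1) h⟩
  refine ge_of_tendsto (((cdf ν).right_continuous z).mono_left
    (nhdsWithin_mono z Set.Ioi_subset_Ici_self)) ?_
  filter_upwards [self_mem_nhdsWithin] with y hy
  obtain ⟨w, hw, hwy⟩ := (csInf_lt_iff (bddBelow_setOf_le_cdf ν hτ.1)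
    (nonempty_setOf_le_cdf ν hτ.2)).1 (h.trans_lt hy)
  exact le_trans hw (monotone_cdf ν hwy.le)

lemma monotoneOn_quantileFn (ν : Measure ℝ) :
    MonotoneOn (quantileFn ν) (Set.Ioo (0 : ℝ) 1) := fun _ hs _ ht hst =>
  (quantileFn_le_iff ν hs _).2 (hst.trans ((quantileFn_le_iff ν ht _).1 le_rfl))

lemma aemeasurable_quantileFn (ν : Measure ℝ) :
    AEMeasurable (quantileFn ν) (volume.restrict (Set.Ioo (0 : ℝ) 1)) :=
  aemeasurable_restrict_of_monotoneOn measurableSet_Ioo (monotoneOn_quantileFn ν)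

/-- The quantile function transports the uniform distribution on the unit interval to `ν`. -/
lemma map_quantileFn (ν : Measure ℝ) [IsProbabilityMeasure ν] :
    (volume.restrict (Set.Ioo (0 : ℝ) 1)).map (quantileFn ν) = ν := by
  have : IsProbabilityMeasure (volume.restrict (Set.Ioo (0 : ℝ) 1)) := ⟨by simp⟩
  have := Measure.isProbabilityMeasure_map (aemeasurable_quantileFn ν)
  refine Measure.ext_of_Iic _ _ fun z => ?_
  rw [Measure.map_apply_of_aemeasurable (aemeasurable_quantileFn ν) measurableSet_Iic,
    Measure.restrict_apply' measurableSet_Ioo, ← ofReal_cdf]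
  have h : quantileFn ν ⁻¹' Set.Iic z ∩ Set.Ioo (0 : ℝ) 1
      = Set.Iic (cdf ν z) ∩ Set.Ioo (0 : ℝ) 1 := by
    ext τ
    simp only [Set.mem_inter_iff, Set.mem_preimage, Set.mem_Iic]
    exact and_congr_left fun hτ => quantileFn_le_iff ν hτ z
  have h' : volume (Set.Iic (cdf ν z) ∩ Set.Ioo (0 : ℝ) 1)
      = volume (Set.Iic (cdf ν z) ∩ Set.Ioc (0 : ℝ) 1) :=
    measure_congr ((ae_eq_refl _).inter Ioo_ae_eq_Ioc)
  have h'' : Set.Iic (cdf ν z) ∩ Set.Ioc (0 : ℝ) 1 = Set.Ioc 0 (cdf ν z) := by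
    ext τ
    have := cdf_le_one ν z
    simp only [Set.mem_inter_iff, Set.mem_Iic, Set.mem_Ioc]
    constructor
    · rintro ⟨h1, h2, -⟩
      exact ⟨h2, h1⟩
    · rintro ⟨h1, h2⟩
      exact ⟨h2, h1, h2.trans this⟩
  rw [h, h', h'', Real.volume_Ioc, sub_zero]

lemma intervalIntegrable_quantileFn (ν : Measure ℝ) [IsProbabilityMeasure ν]
    (hν : Integrable (fun z => z) ν) : IntervalIntegrable (quantileFn ν) volume 0 1 := by
  rw [intervalIntegrable_iff_integrableOn_Ioo_of_le zero_le_one]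
  rw [← map_quantileFn ν] at hν
  exact (integrable_map_measure aestronglyMeasurable_id (aemeasurable_quantileFn ν)).1 hν

lemma integral_quantileFn (ν : Measure ℝ) [IsProbabilityMeasure ν] :
    ∫ τ in (0 : ℝ)..1, quantileFn ν τ = ∫ z, z ∂ν := by
  rw [intervalIntegral.integral_of_le zero_le_one, integral_Ioc_eq_integral_Ioo]
  conv_rhs => rw [← map_quantileFn ν]
  exact (integral_map (aemeasurable_quantileFn ν) aestronglyMeasurable_id).symm

/-- The mean is the convex combination of the two average values-at-risk. -/
lemma avarLeft_avarRight_combination {α : ℝ} (hα : α ∈ Set.Ioo (0 : ℝ) 1) (ν : Measure ℝ)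
    [IsProbabilityMeasure ν] (hν : Integrable (fun z => z) ν) :
    α * avarLeft α ν + (1 - α) * avarRight α ν = ∫ z, z ∂ν := by
  have hi := intervalIntegrable_quantileFn ν hν
  have hmem : α ∈ Set.uIcc (0 : ℝ) 1 := by
    rw [Set.uIcc_of_le zero_le_one]
    exact ⟨hα.1.le, hα.2.le⟩
  have h1 : IntervalIntegrable (quantileFn ν) volume 0 α :=
    hi.mono_set (Set.uIcc_subset_uIcc_left hmem)
  have h2 : IntervalIntegrable (quantileFn ν) volume α 1 :=
    hi.mono_set (Set.uIcc_subset_uIcc_right hmem)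
  have hα0 : α ≠ 0 := hα.1.ne'
  have hα1 : 1 - α ≠ 0 := (sub_pos.2 hα.2).ne'
  rw [← integral_quantileFn ν, ← intervalIntegral.integral_add_adjacent_intervals h1 h2,
    avarLeft, avarRight]
  field_simp

lemma avarLeft_le_avarRight {α : ℝ} (hα : α ∈ Set.Ioo (0 : ℝ) 1) (ν : Measure ℝ)
    [IsProbabilityMeasure ν] (hν : Integrable (fun z => z) ν) :
    avarLeft α ν ≤ avarRight α ν := by
  have hi := intervalIntegrable_quantileFn ν hν
  have hmem : α ∈ Set.uIcc (0 : ℝ) 1 := by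
    rw [Set.uIcc_of_le zero_le_one]
    exact ⟨hα.1.le, hα.2.le⟩
  have h1 : IntervalIntegrable (quantileFn ν) volume 0 α :=
    hi.mono_set (Set.uIcc_subset_uIcc_left hmem)
  have h2 : IntervalIntegrable (quantileFn ν) volume α 1 :=
    hi.mono_set (Set.uIcc_subset_uIcc_right hmem)
  have hpos : 0 < 1 - α := sub_pos.2 hα.2
  have hl : ∫ τ in (0 : ℝ)..α, quantileFn ν τ ≤ ∫ _ in (0 : ℝ)..α, quantileFn ν α :=
    intervalIntegral.integral_mono_on_of_le_Ioo hα.1.le h1 intervalIntegrable_const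
      fun τ hτ => monotoneOn_quantileFn ν ⟨hτ.1, hτ.2.trans hα.2⟩ hα hτ.2.le
  have hr : ∫ _ in α..(1 : ℝ), quantileFn ν α ≤ ∫ τ in α..(1 : ℝ), quantileFn ν τ :=
    intervalIntegral.integral_mono_on_of_le_Ioo hα.2.le intervalIntegrable_const h2
      fun τ hτ => monotoneOn_quantileFn ν hα ⟨hα.1.trans hτ.1, hτ.2⟩ hτ.1.le
  rw [intervalIntegral.integral_const, smul_eq_mul] at hl hr
  refine le_trans (b := quantileFn ν α) ?_ ?_
  · rw [avarLeft, one_div_mul_eq_div, div_le_iff₀ hα.1]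
    linarith
  · rw [avarRight, one_div_mul_eq_div, le_div_iff₀ hpos]
    linarith

lemma sum_transition_mul_policy (M : MDP X A) {π : X → A → ℝ} (hπ : IsPolicy π) (x : X) (a : A) :
    ∑ x', ∑ a', M.P x a x' * π x' a' = 1 := by
  simp_rw [← Finset.mul_sum, hπ.2, mul_one]
  exact M.P_sum_one x a

lemma isProbabilityMeasure_diatomicMeasure (M : MDP X A) {α : ℝ} (hα : α ∈ Set.Ioo (0 : ℝ) 1)
    {π : X → A → ℝ} (hπ : IsPolicy π) (Q : X → A → ℝ × ℝ) (x : X) (a : A) :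
    IsProbabilityMeasure (diatomicMeasure M α π Q x a) := by
  have h0 : ∀ x' a', 0 ≤ M.P x a x' * π x' a' := fun x' a' =>
    mul_nonneg (M.P_nonneg _ _ _) (hπ.1 _ _)
  refine ⟨?_⟩
  have hα' : ENNReal.ofReal α + ENNReal.ofReal (1 - α) = 1 := by
    rw [← ENNReal.ofReal_add hα.1.le (sub_pos.2 hα.2).le, add_sub_cancel, ENNReal.ofReal_one]
  simp only [diatomicMeasure, Measure.coe_finsetSum, Finset.sum_apply, Measure.smul_apply,
    Measure.add_apply, measure_univ, smul_eq_mul, mul_one, hα']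
  simp_rw [← ENNReal.ofReal_sum_of_nonneg fun a' _ => h0 _ a']
  rw [← ENNReal.ofReal_sum_of_nonneg fun x' _ => Finset.sum_nonneg fun a' _ => h0 x' a',
    sum_transition_mul_policy M hπ, ENNReal.ofReal_one]

lemma integrable_diatomicMeasure (M : MDP X A) (α : ℝ) (π : X → A → ℝ)
    (Q : X → A → ℝ × ℝ) (x : X) (a : A) (f : ℝ → ℝ) :
    Integrable f (diatomicMeasure M α π Q x a) := by
  refine integrable_finsetSum_measure.2 fun x' _ => integrable_finsetSum_measure.2 fun a' _ => ?_
  refine Integrable.smul_measure (Integrable.add_measure ?_ ?_) ENNReal.ofReal_ne_top <;>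
  exact (integrable_dirac (by simp)).smul_measure ENNReal.ofReal_ne_top

lemma integral_diatomicMeasure (M : MDP X A) {α : ℝ} (hα : α ∈ Set.Ioo (0 : ℝ) 1)
    {π : X → A → ℝ} (hπ : IsPolicy π) (Q : X → A → ℝ × ℝ) (x : X) (a : A) :
    ∫ z, z ∂diatomicMeasure M α π Q x a = ∑ x', ∑ a', M.P x a x' * π x' a' *
      (M.r x a x' + M.γ * (α * (Q x' a').1 + (1 - α) * (Q x' a').2)) := by
  have hd : ∀ (c y : ℝ), Integrable (fun z : ℝ => z) (ENNReal.ofReal c • Measure.dirac y) :=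
    fun c y => (integrable_dirac (by simp)).smul_measure ENNReal.ofReal_ne_top
  have hs : ∀ x' a', Integrable (fun z : ℝ => z) (ENNReal.ofReal (M.P x a x' * π x' a') •
      (ENNReal.ofReal α • Measure.dirac (M.r x a x' + M.γ * (Q x' a').1)
        + ENNReal.ofReal (1 - α) • Measure.dirac (M.r x a x' + M.γ * (Q x' a').2))) :=
    fun x' a' => ((hd _ _).add_measure (hd _ _)).smul_measure ENNReal.ofReal_ne_top
  rw [diatomicMeasure, integral_finsetSum_measure fun x' _ =>
    integrable_finsetSum_measure.2 fun a' _ => hs x' a']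
  refine Finset.sum_congr rfl fun x' _ => ?_
  rw [integral_finsetSum_measure fun a' _ => hs x' a']
  refine Finset.sum_congr rfl fun a' _ => ?_
  rw [integral_smul_measure, integral_add_measure (hd _ _) (hd _ _), integral_smul_measure,
    integral_smul_measure, integral_dirac, integral_dirac,
    ENNReal.toReal_ofReal (mul_nonneg (M.P_nonneg _ _ _) (hπ.1 _ _)),
    ENNReal.toReal_ofReal hα.1.le, ENNReal.toReal_ofReal (sub_pos.2 hα.2).le]
  simp only [smul_eq_mul]
  ring

/-- The classical Bellman equation for policy evaluation has at most one solution. -/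
lemma bellman_solution_unique (M : MDP X A) {π : X → A → ℝ} (hπ : IsPolicy π)
    {U V : X → A → ℝ}
    (hU : ∀ x a, U x a = ∑ x', ∑ a', M.P x a x' * π x' a' * (M.r x a x' + M.γ * U x' a'))
    (hV : ∀ x a, V x a = ∑ x', ∑ a', M.P x a x' * π x' a' * (M.r x a x' + M.γ * V x' a'))
    (x : X) (a : A) : U x a = V x a := by
  have : Nonempty (X × A) := ⟨(x, a)⟩
  obtain ⟨⟨y, b⟩, hmax⟩ := Finite.exists_max fun p : X × A => |U p.1 p.2 - V p.1 p.2|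
  have hle : |U y b - V y b| ≤ M.γ * |U y b - V y b| := by
    calc |U y b - V y b|
        = |∑ x', ∑ a', M.P y b x' * π x' a' * (M.γ * (U x' a' - V x' a'))| := by
          rw [hU y b, hV y b, ← Finset.sum_sub_distrib]
          simp_rw [← Finset.sum_sub_distrib]
          congr 1
          refine Finset.sum_congr rfl fun x' _ => Finset.sum_congr rfl fun a' _ => ?_
          ring
      _ ≤ ∑ x', ∑ a', M.P y b x' * π x' a' * (M.γ * |U y b - V y b|) := by
          refine (Finset.abs_sum_le_sum_abs _ _).trans (Finset.sum_le_sum fun x' _ =>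
            (Finset.abs_sum_le_sum_abs _ _).trans (Finset.sum_le_sum fun a' _ => ?_))
          have h0 := mul_nonneg (M.P_nonneg y b x') (hπ.1 x' a')
          rw [abs_mul, abs_of_nonneg h0, abs_mul, abs_of_nonneg M.γ_nonneg]
          exact mul_le_mul_of_nonneg_left
            (mul_le_mul_of_nonneg_left (hmax (x', a')) M.γ_nonneg) h0
      _ = M.γ * |U y b - V y b| := by
          simp_rw [← Finset.sum_mul]
          rw [sum_transition_mul_policy M hπ, one_mul]
  have hzero : |U y b - V y b| ≤ 0 := by
    nlinarith [abs_nonneg (U y b - V y b), M.γ_lt_one]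
  exact sub_eq_zero.1 (abs_nonpos_iff.1 ((hmax (x, a)).trans hzero))

theorem stmt9 (M : MDP X A) (α : ℝ) (hα : α ∈ Set.Ioo (0:ℝ) 1)
    (π : X → A → ℝ) (hπ : IsPolicy π)
    (Qpi : X → A → ℝ × ℝ) (hfix : diatomicT M α π Qpi = Qpi)
    (Qcl : X → A → ℝ)
    (hQcl : ∀ x a, Qcl x a =
      ∑ x', ∑ a', M.P x a x' * π x' a' * (M.r x a x' + M.γ * Qcl x' a')) :
    ∀ x a, (Qpi x a).1 ≤ Qcl x a ∧ Qcl x a ≤ (Qpi x a).2 := by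
  have hleft : ∀ x a, avarLeft α (diatomicMeasure M α π Qpi x a) = (Qpi x a).1 := fun x a =>
    congrArg Prod.fst (congrFun (congrFun hfix x) a)
  have hright : ∀ x a, avarRight α (diatomicMeasure M α π Qpi x a) = (Qpi x a).2 := fun x a =>
    congrArg Prod.snd (congrFun (congrFun hfix x) a)
  have hbell : ∀ x a, α * (Qpi x a).1 + (1 - α) * (Qpi x a).2 =
      ∑ x', ∑ a', M.P x a x' * π x' a' *
        (M.r x a x' + M.γ * (α * (Qpi x' a').1 + (1 - α) * (Qpi x' a').2)) := fun x a => by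
    have := isProbabilityMeasure_diatomicMeasure M hα hπ Qpi x a
    rw [← integral_diatomicMeasure M hα hπ, ← avarLeft_avarRight_combination hα _
      (integrable_diatomicMeasure M α π Qpi x a _), hleft, hright]
  intro x a
  have hQ := bellman_solution_unique M hπ hQcl hbell x a
  have := isProbabilityMeasure_diatomicMeasure M hα hπ Qpi x a
  have hle := avarLeft_le_avarRight hα _ (integrable_diatomicMeasure M α π Qpi x a _)
  rw [hleft, hright] at hle
  rw [hQ]
  constructor <;> nlinarith [hα.1, hα.2]

end
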